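/- Let $\kappa_1 < \kappa_2 < \cdots < \kappa_n$ be real numbers, let $A$ be a real $k\times n$ matrix ($k\le n$), and set $f^{(i)}(x,y,t) = \sum_{j=1}^n A^i_j E_j(x,y,t)$ where $E_j = \exp(\kappa_j x + \kappa_j^2 y + \kappa_j^3 t)$. Then the Wronskian in $x$ satisfies the Cauchy–Binet expansion $\mathrm{Wr}_x(f^{(1)},\dots,f^{(k)})(x,y,t) = \sum_{1\le j_1 < \cdots < j_k \le n} \Delta_{(j_1,\dots,j_k)}(A) \prod_{1\le r<s\le k}(\kappa_{j_s}-\kappa_{j_r}) \prod_{l=1}^k E_{j_l}(x,y,t)$. -/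

import Mathlib

open scoped BigOperators

namespace Matrix

/-- Expansion of the determinant of a product over all choices of inner indices. -/
theorem det_mul_eq_sum_prod_mul_det_submatrix {m n R : Type*} [Fintype m] [DecidableEq m]
    [Fintype n] [DecidableEq n] [CommRing R] (M : Matrix m n R) (N : Matrix n m R) :
    (M * N).det = ∑ J : m → n, (∏ i, N (J i) i) * (M.submatrix id J).det := by
  have h : (M * N)ᵀ = fun i => ∑ j, N j i • Mᵀ j := by
    ext i r
    simp [Matrix.mul_apply, Finset.sum_apply, mul_comm]
  rw [← det_transpose, h]
  change (detRowAlternating (R := R) (n := m)).toMultilinearMap _ = _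
  rw [MultilinearMap.map_sum]
  refine Finset.sum_congr rfl fun J _ => ?_
  rw [MultilinearMap.map_smul_univ, smul_eq_mul, ← det_transpose]
  rfl

/-- The **Cauchy–Binet formula**. -/
theorem det_mul_eq_sum_strictMono {n R : Type*} [Fintype n] [LinearOrder n] [CommRing R] {k : ℕ}
    (M : Matrix (Fin k) n R) (N : Matrix n (Fin k) R)
    [DecidablePred fun J : Fin k → n => StrictMono J] :
    (M * N).det = ∑ J : Fin k → n with StrictMono J,
      (M.submatrix id J).det * (N.submatrix J id).det := by
  classical
  rw [det_mul_eq_sum_prod_mul_det_submatrix]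
  have hinj : ∑ J : Fin k → n with Function.Injective J,
      (∏ i, N (J i) i) * (M.submatrix id J).det =
      ∑ J : Fin k → n, (∏ i, N (J i) i) * (M.submatrix id J).det := by
    refine Finset.sum_filter_of_ne fun J _ hJ => ?_
    by_contra hni
    simp only [Function.Injective, not_forall] at hni
    obtain ⟨a, b, hab, hne⟩ := hni
    exact hJ (by rw [det_zero_of_column_eq hne fun r => by simp [hab], mul_zero])
  rw [← hinj]
  have hexp : ∀ J : Fin k → n, (M.submatrix id J).det * (N.submatrix J id).det =
      ∑ σ : Equiv.Perm (Fin k),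
        (∏ i, N ((J ∘ σ) i) i) * (M.submatrix id (J ∘ σ)).det := by
    intro J
    rw [det_apply' (N.submatrix J id), Finset.mul_sum]
    refine Finset.sum_congr rfl fun σ _ => ?_
    have := det_permute' σ (M.submatrix id J)
    rw [submatrix_submatrix] at this
    rw [show M.submatrix id (J ∘ σ) = M.submatrix (id ∘ id) (J ∘ σ) from rfl, this]
    simp only [submatrix_apply, Function.comp_apply, id]
    ring
  simp_rw [hexp]
  rw [← Finset.sum_product']
  symm
  refine Finset.sum_bij (fun p _ => p.1 ∘ p.2) ?_ ?_ ?_ ?_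
  · rintro ⟨J, σ⟩ h
    simp only [Finset.mem_product, Finset.mem_filter, Finset.mem_univ, true_and, and_true] at h ⊢
    exact h.injective.comp σ.injective
  · rintro ⟨J, σ⟩ h ⟨J', σ'⟩ h' heq
    simp only [Finset.mem_product, Finset.mem_filter, Finset.mem_univ, true_and, and_true]
      at h h' heq
    have hr : Set.range J = Set.range J' := by
      rw [← σ.surjective.range_comp J, heq, σ'.surjective.range_comp]
    obtain rfl := (h.range_inj h').1 hr
    refine Prod.ext rfl (Equiv.ext fun i => h.injective (congrFun heq i))
  · intro J hJ
    simp only [Finset.mem_filter, Finset.mem_univ, true_and] at hJ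
    refine ⟨(J ∘ Tuple.sort J, (Tuple.sort J)⁻¹), ?_, ?_⟩
    · simp only [Finset.mem_product, Finset.mem_filter, Finset.mem_univ, true_and, and_true]
      exact (Tuple.monotone_sort J).strictMono_of_injective
        (hJ.comp (Tuple.sort J).injective)
    · funext i
      simp
  · intro _ _
    rfl

end Matrix

theorem iteratedDeriv_sum_mul_exp {ι : Type*} [Fintype ι] (c a b : ι → ℝ) (m : ℕ) :
    iteratedDeriv m (fun x => ∑ j, c j * Real.exp (a j * x + b j)) =
      fun x => ∑ j, c j * (a j ^ m * Real.exp (a j * x + b j)) := by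
  induction m with
  | zero => simp
  | succ m ih =>
    rw [iteratedDeriv_succ, ih]
    funext x
    refine HasDerivAt.deriv (HasDerivAt.fun_sum fun j _ => ?_)
    have h := ((((hasDerivAt_id x).const_mul (a j)).add_const (b j)).exp.const_mul
      (a j ^ m)).const_mul (c j)
    exact h.congr_deriv (by simp only [id]; ring)

theorem stmt4 (k n : ℕ) (hkn : k ≤ n) (κ : Fin n → ℝ) (hκ : StrictMono κ)
    (A : Fin k → Fin n → ℝ)
    (E : Fin n → ℝ → ℝ → ℝ → ℝ)
    (hE : ∀ j x y t, E j x y t = Real.exp (κ j * x + κ j ^ 2 * y + κ j ^ 3 * t))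
    (f : Fin k → ℝ → ℝ → ℝ → ℝ)
    (hf : ∀ i x y t, f i x y t = ∑ j, A i j * E j x y t) (x y t : ℝ) :
    Matrix.det (Matrix.of fun r i : Fin k =>
        iteratedDeriv (r : ℕ) (fun x' => f i x' y t) x) =
      ∑ J ∈ Finset.univ.filter
          (fun J : Fin k → Fin n => ∀ a b : Fin k, a < b → J a < J b),
        Matrix.det (Matrix.of fun i l : Fin k => A i (J l)) *
          (∏ p ∈ Finset.univ.filter (fun p : Fin k × Fin k => p.1 < p.2),
            (κ (J p.2) - κ (J p.1))) *
          ∏ l, E (J l) x y t := by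
  have hW : (Matrix.of fun r i : Fin k => iteratedDeriv (r : ℕ) (fun x' => f i x' y t) x) =
      (Matrix.of fun (r : Fin k) (j : Fin n) => κ j ^ (r : ℕ)) *
        (Matrix.of fun (j : Fin n) (i : Fin k) => E j x y t * A i j) := by
    ext r i
    have h := congrFun (iteratedDeriv_sum_mul_exp (A i) κ
      (fun j => κ j ^ 2 * y + κ j ^ 3 * t) r) x
    simp only [Matrix.of_apply, Matrix.mul_apply, hf, hE, add_assoc, h]
    exact Finset.sum_congr rfl fun j _ => by ring
  classical
  rw [hW, Matrix.det_mul_eq_sum_strictMono]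
  refine Finset.sum_congr (by ext J; rw [Finset.mem_filter, Finset.mem_filter]; rfl) fun J _ => ?_
  have hV : ((Matrix.of fun (r : Fin k) (j : Fin n) => κ j ^ (r : ℕ)).submatrix id J).det =
      ∏ p ∈ Finset.univ.filter (fun p : Fin k × Fin k => p.1 < p.2),
        (κ (J p.2) - κ (J p.1)) := by
    rw [← Matrix.det_transpose]
    refine (Matrix.det_vandermonde fun l => κ (J l)).trans ?_
    rw [Finset.prod_filter, ← Finset.univ_product_univ, Finset.prod_product]
    refine Finset.prod_congr rfl fun a _ => ?_
    rw [← Finset.prod_filter]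
    exact Finset.prod_congr (by ext; simp) fun _ _ => rfl
  have hN : ((Matrix.of fun (j : Fin n) (i : Fin k) => E j x y t * A i j).submatrix J id).det =
      (∏ l, E (J l) x y t) * Matrix.det (Matrix.of fun i l : Fin k => A i (J l)) := by
    rw [← Matrix.det_transpose (Matrix.of fun i l : Fin k => A i (J l)),
      ← Matrix.det_mul_column]
    rfl
  rw [hV, hN]
  ring
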